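/- (Example 3: quasi-bi-inverse-Hamiltonian chains.) On ℝ⁶ with coordinates (q₁,q₂,q₃,p₁,p₂,p₃), let h₁^{(1)}, h₁^{(2)}, h₂^{(2)} be as in Example 3 (h₁^{(1)} = p₂p₃ + (1/3)p₂² + p₃² − 7q₁²p₃ − 4q₁²p₂ − 3q₂p₁ + 18q₁q₂² + 13q₁⁴ + 12q₃q₁q₂; h₁^{(2)} = 12q₁³q₂ + 8q₁³q₃ − 2q₁²p₁ + (−6q₁q₂ − 4q₁q₃)p₃ + p₁p₃; h₂^{(2)} = (1/3)p₂p₃² + (1/3)p₂²p₃ + (2/27)p₂³ − q₁²p₃² − (4/3)q₁²p₂² − q₂p₁p₂ − q₁p₁² − (10/3)q₁²p₃p₂ + (q₃ − 3q₂)p₁p₃ + (21q₁²q₂ + 6q₃q₁²)p₁ + (4q₃q₁q₂ + 6q₁q₂² + (22/3)q₁⁴)p₂ + (7q₁⁴ + 18q₁q₂² + 6q₃q₁q₂ − 4q₁q₃²)p₃ − 8q₁³q₃² − 72q₃q₁³q₂ − 90q₁³q₂² − 12q₁⁶), and set x_i^{(k)} := π₀∇h_i^{(k)}. Let A := (1/3)p₂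 + (1/3)p₃ − 3q₁², B := 54q₁q₂ + 24q₁q₃ − 3p₁, C := −24q₁q₂ − 12q₁q₃ + p₁, and let ω₁ be the 6×6 matrix with rows (0, −B, −C, q₃, −A, −2q₁²), (B, 0, 24q₁², −3q₁, −3q₂ + q₃, 0), (C, −24q₁², 0, 2q₁, q₂, q₃), (−q₃, 3q₁, −2q₁, 0, 0, 0), (A, 3q₂ − q₃, −q₂, 0, 0, (1/3)q₁), (2q₁², 0, −q₃, 0, −(1/3)q₁, 0). Then at every point of ℝ⁶: ω₁x₁^{(1)} = (−q₃)∇h₁^{(1)} + (−q₁)∇h₁^{(2)}; ω₁x₁^{(2)} = ∇h₂^{(2)} + (−(1/3)p₂ + q₁²)∇h₁^{(1)} + (−2q₃ + 3q₂)∇h₁^{(2)}; ω₁x₂^{(2)} = (5q₃q₁² + 6q₁²q₂ − q₁p₁ − (1/3)q₃p₂)∇h₁^{(1)} + (−4q₁³ − q₃² + 3q₂q₃ + (2/3)q₁p₂ + q₁p₃)∇h₁^{(2)}. (These are the relations ω₁x_i^{(k)} = ω₀x_{i+1}^{(k)} + Σ_l F_i^{(k,l)}ω₀x₁^{(l)},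 since ω₀x_i^{(k)} = ∇h_i^{(k)}.) -/

import Mathlib

noncomputable section Stmt18

/-- Partial derivative in the `i`-th coordinate direction on `ℝ⁶`. -/
def pd (i : Fin 6) (F : (Fin 6 → ℝ) → ℝ) (x : Fin 6 → ℝ) : ℝ :=
  fderiv ℝ F x (Pi.single i 1)

/-- Gradient on `ℝ⁶`, coordinates `(q₁,q₂,q₃,p₁,p₂,p₃) = (x 0,…,x 5)`. -/
def grad (F : (Fin 6 → ℝ) → ℝ) (x : Fin 6 → ℝ) : Fin 6 → ℝ :=
  fun i => pd i F x

/-- The canonical Poisson matrix `π₀ = [[0₃, I₃],[−I₃, 0₃]]`. -/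
def pi0 : Matrix (Fin 6) (Fin 6) ℝ :=
  !![0,0,0,1,0,0; 0,0,0,0,1,0; 0,0,0,0,0,1;
     -1,0,0,0,0,0; 0,-1,0,0,0,0; 0,0,-1,0,0,0]

def h11 (x : Fin 6 → ℝ) : ℝ :=
  x 4 * x 5 + (1/3) * x 4 ^ 2 + x 5 ^ 2 - 7 * x 0 ^ 2 * x 5 - 4 * x 0 ^ 2 * x 4
    - 3 * x 1 * x 3 + 18 * x 0 * x 1 ^ 2 + 13 * x 0 ^ 4 + 12 * x 2 * x 0 * x 1

def h12 (x : Fin 6 → ℝ) : ℝ :=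
  12 * x 0 ^ 3 * x 1 + 8 * x 0 ^ 3 * x 2 - 2 * x 0 ^ 2 * x 3
    + (-6 * x 0 * x 1 - 4 * x 0 * x 2) * x 5 + x 3 * x 5

def h22 (x : Fin 6 → ℝ) : ℝ :=
  (1/3) * x 4 * x 5 ^ 2 + (1/3) * x 4 ^ 2 * x 5 + (2/27) * x 4 ^ 3
    - x 0 ^ 2 * x 5 ^ 2 - (4/3) * x 0 ^ 2 * x 4 ^ 2 - x 1 * x 3 * x 4
    - x 0 * x 3 ^ 2 - (10/3) * x 0 ^ 2 * x 5 * x 4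
    + (x 2 - 3 * x 1) * x 3 * x 5 + (21 * x 0 ^ 2 * x 1 + 6 * x 2 * x 0 ^ 2) * x 3
    + (4 * x 2 * x 0 * x 1 + 6 * x 0 * x 1 ^ 2 + (22/3) * x 0 ^ 4) * x 4
    + (7 * x 0 ^ 4 + 18 * x 0 * x 1 ^ 2 + 6 * x 2 * x 0 * x 1 - 4 * x 0 * x 2 ^ 2) * x 5
    - 8 * x 0 ^ 3 * x 2 ^ 2 - 72 * x 2 * x 0 ^ 3 * x 1 - 90 * x 0 ^ 3 * x 1 ^ 2
    - 12 * x 0 ^ 6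

def A (x : Fin 6 → ℝ) : ℝ := (1/3) * x 4 + (1/3) * x 5 - 3 * x 0 ^ 2
def B (x : Fin 6 → ℝ) : ℝ := 54 * x 0 * x 1 + 24 * x 0 * x 2 - 3 * x 3
def C (x : Fin 6 → ℝ) : ℝ := -24 * x 0 * x 1 - 12 * x 0 * x 2 + x 3

/-- The second (noncanonical) symplectic form of Example 3. -/
def omega1 (x : Fin 6 → ℝ) : Matrix (Fin 6) (Fin 6) ℝ :=
  !![0, -B x, -C x, x 2, -A x, -2 * x 0 ^ 2;
     B x, 0, 24 * x 0 ^ 2, -3 * x 0, -3 * x 1 + x 2, 0;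
     C x, -24 * x 0 ^ 2, 0, 2 * x 0, x 1, x 2;
     -x 2, 3 * x 0, -2 * x 0, 0, 0, 0;
     A x, 3 * x 1 - x 2, -x 1, 0, 0, (1/3) * x 0;
     2 * x 0 ^ 2, 0, -x 2, 0, -(1/3) * x 0, 0]

theorem pd_add (i : Fin 6) (F G : (Fin 6 → ℝ) → ℝ) (x : Fin 6 → ℝ)
    (hF : DifferentiableAt ℝ F x) (hG : DifferentiableAt ℝ G x) :
    pd i (fun y => F y + G y) x = pd i F x + pd i G x := by
  simp [pd, fderiv_fun_add hF hG]

theorem pd_sub (i : Fin 6) (F G : (Fin 6 → ℝ) → ℝ) (x : Fin 6 → ℝ)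
    (hF : DifferentiableAt ℝ F x) (hG : DifferentiableAt ℝ G x) :
    pd i (fun y => F y - G y) x = pd i F x - pd i G x := by
  simp [pd, fderiv_fun_sub hF hG]

theorem pd_mul (i : Fin 6) (F G : (Fin 6 → ℝ) → ℝ) (x : Fin 6 → ℝ)
    (hF : DifferentiableAt ℝ F x) (hG : DifferentiableAt ℝ G x) :
    pd i (fun y => F y * G y) x = F x * pd i G x + G x * pd i F x := by
  simp [pd, fderiv_fun_mul hF hG]

theorem pd_pow (i : Fin 6) (F : (Fin 6 → ℝ) → ℝ) (n : ℕ) (x : Fin 6 → ℝ)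
    (hF : DifferentiableAt ℝ F x) :
    pd i (fun y => F y ^ n) x = n * F x ^ (n - 1) * pd i F x := by
  simp [pd, fderiv_fun_pow n hF]

theorem pd_const (i : Fin 6) (c : ℝ) (x : Fin 6 → ℝ) :
    pd i (fun _ => c) x = 0 := by
  simp [pd]

theorem pd_coord (i j : Fin 6) (x : Fin 6 → ℝ) :
    pd i (fun y => y j) x = if j = i then 1 else 0 := by
  have h : HasFDerivAt (fun y : Fin 6 → ℝ => y j)
      (ContinuousLinearMap.proj (R := ℝ) (φ := fun _ : Fin 6 => ℝ) j) x :=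
    (ContinuousLinearMap.proj (R := ℝ) (φ := fun _ : Fin 6 => ℝ) j).hasFDerivAt
  simp [pd, h.fderiv, Pi.single_apply]

theorem pd_h11 (x : Fin 6 → ℝ) (i : Fin 6) : grad h11 x i = pd i (fun x : Fin 6 → ℝ =>
  x 4 * x 5 + (1/3) * x 4 ^ 2 + x 5 ^ 2 - 7 * x 0 ^ 2 * x 5 - 4 * x 0 ^ 2 * x 4
    - 3 * x 1 * x 3 + 18 * x 0 * x 1 ^ 2 + 13 * x 0 ^ 4 + 12 * x 2 * x 0 * x 1) x := rfl

theorem pd_h12 (x : Fin 6 → ℝ) (i : Fin 6) : grad h12 x i = pd i (fun x : Fin 6 → ℝ =>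
  12 * x 0 ^ 3 * x 1 + 8 * x 0 ^ 3 * x 2 - 2 * x 0 ^ 2 * x 3
    + (-6 * x 0 * x 1 - 4 * x 0 * x 2) * x 5 + x 3 * x 5) x := rfl

theorem pd_h22 (x : Fin 6 → ℝ) (i : Fin 6) : grad h22 x i = pd i (fun x : Fin 6 → ℝ =>
  (1/3) * x 4 * x 5 ^ 2 + (1/3) * x 4 ^ 2 * x 5 + (2/27) * x 4 ^ 3
    - x 0 ^ 2 * x 5 ^ 2 - (4/3) * x 0 ^ 2 * x 4 ^ 2 - x 1 * x 3 * x 4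
    - x 0 * x 3 ^ 2 - (10/3) * x 0 ^ 2 * x 5 * x 4
    + (x 2 - 3 * x 1) * x 3 * x 5 + (21 * x 0 ^ 2 * x 1 + 6 * x 2 * x 0 ^ 2) * x 3
    + (4 * x 2 * x 0 * x 1 + 6 * x 0 * x 1 ^ 2 + (22/3) * x 0 ^ 4) * x 4
    + (7 * x 0 ^ 4 + 18 * x 0 * x 1 ^ 2 + 6 * x 2 * x 0 * x 1 - 4 * x 0 * x 2 ^ 2) * x 5
    - 8 * x 0 ^ 3 * x 2 ^ 2 - 72 * x 2 * x 0 ^ 3 * x 1 - 90 * x 0 ^ 3 * x 1 ^ 2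
    - 12 * x 0 ^ 6) x := rfl

theorem grad_h11 (x : Fin 6 → ℝ) : grad h11 x = ![
    (-14) * x 0 * x 5 + (-8) * x 0 * x 4 + (18) * x 1 ^ 2 + (52) * x 0 ^ 3 + (12) * x 1 * x 2,
    (-3) * x 3 + (36) * x 0 * x 1 + (12) * x 0 * x 2,
    (12) * x 0 * x 1,
    (-3) * x 1,
    (1) * x 5 + (2/3) * x 4 + (-4) * x 0 ^ 2,
    (1) * x 4 + (2) * x 5 + (-7) * x 0 ^ 2] := by
  ext i
  rw [pd_h11]
  simp (disch := fun_prop) only [pd_add, pd_sub, pd_mul, pd_pow, pd_const, pd_coord]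
  fin_cases i <;> simp <;> ring

theorem grad_h12 (x : Fin 6 → ℝ) : grad h12 x = ![
    (36) * x 0 ^ 2 * x 1 + (24) * x 0 ^ 2 * x 2 + (-4) * x 0 * x 3 + (-6) * x 1 * x 5 + (-4) * x 2 * x 5,
    (12) * x 0 ^ 3 + (-6) * x 0 * x 5,
    (8) * x 0 ^ 3 + (-4) * x 0 * x 5,
    (-2) * x 0 ^ 2 + (1) * x 5,
    0,
    (-6) * x 0 * x 1 + (-4) * x 0 * x 2 + (1) * x 3] := by
  ext i
  rw [pd_h12]
  simp (disch := fun_prop) only [pd_add, pd_sub, pd_mul, pd_pow, pd_const, pd_coord]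
  fin_cases i <;> simp <;> ring

theorem grad_h22 (x : Fin 6 → ℝ) : grad h22 x = ![
    (-2) * x 0 * x 5 ^ 2 + (-8/3) * x 0 * x 4 ^ 2 + (-1) * x 3 ^ 2 + (-20/3) * x 0 * x 4 * x 5 + (42) * x 0 * x 1 * x 3 + (12) * x 0 * x 2 * x 3 + (4) * x 1 * x 2 * x 4 + (6) * x 1 ^ 2 * x 4 + (88/3) * x 0 ^ 3 * x 4 + (28) * x 0 ^ 3 * x 5 + (18) * x 1 ^ 2 * x 5 + (6) * x 1 * x 2 * x 5 + (-4) * x 2 ^ 2 * x 5 + (-24) * x 0 ^ 2 * x 2 ^ 2 + (-216) * x 0 ^ 2 * x 1 * x 2 + (-270) * x 0 ^ 2 * x 1 ^ 2 + (-72) * x 0 ^ 5,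
    (-1) * x 3 * x 4 + (-3) * x 3 * x 5 + (21) * x 0 ^ 2 * x 3 + (4) * x 0 * x 2 * x 4 + (12) * x 0 * x 1 * x 4 + (36) * x 0 * x 1 * x 5 + (6) * x 0 * x 2 * x 5 + (-72) * x 0 ^ 3 * x 2 + (-180) * x 0 ^ 3 * x 1,
    (1) * x 3 * x 5 + (6) * x 0 ^ 2 * x 3 + (4) * x 0 * x 1 * x 4 + (6) * x 0 * x 1 * x 5 + (-8) * x 0 * x 2 * x 5 + (-16) * x 0 ^ 3 * x 2 + (-72) * x 0 ^ 3 * x 1,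
    (-1) * x 1 * x 4 + (-2) * x 0 * x 3 + (1) * x 2 * x 5 + (-3) * x 1 * x 5 + (21) * x 0 ^ 2 * x 1 + (6) * x 0 ^ 2 * x 2,
    (1/3) * x 5 ^ 2 + (2/3) * x 4 * x 5 + (2/9) * x 4 ^ 2 + (-8/3) * x 0 ^ 2 * x 4 + (-1) * x 1 * x 3 + (-10/3) * x 0 ^ 2 * x 5 + (4) * x 0 * x 1 * x 2 + (6) * x 0 * x 1 ^ 2 + (22/3) * x 0 ^ 4,
    (2/3) * x 4 * x 5 + (1/3) * x 4 ^ 2 + (-2) * x 0 ^ 2 * x 5 + (-10/3) * x 0 ^ 2 * x 4 + (1) * x 2 * x 3 + (-3) * x 1 * x 3 + (7) * x 0 ^ 4 + (18) * x 0 * x 1 ^ 2 + (6) * x 0 * x 1 * x 2 + (-4) * x 0 * x 2 ^ 2] := by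
  ext i
  rw [pd_h22]
  simp (disch := fun_prop) only [pd_add, pd_sub, pd_mul, pd_pow, pd_const, pd_coord]
  fin_cases i <;> simp <;> ring

set_option maxHeartbeats 4000000 in
/-- Example 3: quasi-bi-inverse-Hamiltonian chains
`ω₁xᵢ⁽ᵏ⁾ = ω₀x_{i+1}⁽ᵏ⁾ + Σ_l Fᵢ^{(k,l)} ω₀x₁⁽ˡ⁾` with `xᵢ⁽ᵏ⁾ = π₀∇hᵢ⁽ᵏ⁾`. -/
theorem stmt18 : ∀ x : Fin 6 → ℝ,
    (omega1 x).mulVec (pi0.mulVec (grad h11 x)) =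
      (-x 2) • grad h11 x + (-x 0) • grad h12 x ∧
    (omega1 x).mulVec (pi0.mulVec (grad h12 x)) =
      grad h22 x + (-(1/3) * x 4 + x 0 ^ 2) • grad h11 x
        + (-2 * x 2 + 3 * x 1) • grad h12 x ∧
    (omega1 x).mulVec (pi0.mulVec (grad h22 x)) =
      (5 * x 2 * x 0 ^ 2 + 6 * x 0 ^ 2 * x 1 - x 0 * x 3 - (1/3) * x 2 * x 4) • grad h11 x
        + (-4 * x 0 ^ 3 - x 2 ^ 2 + 3 * x 1 * x 2 + (2/3) * x 0 * x 4 + x 0 * x 5) •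
            grad h12 x := by
  intro x
  rw [grad_h11, grad_h12, grad_h22]
  refine ⟨?_, ?_, ?_⟩ <;> ext i <;> fin_cases i <;>
    simp [Matrix.mulVec, dotProduct, Fin.sum_univ_six, omega1, pi0, A, B, C] <;> ring

end Stmt18
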